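/- Let V be a finite-dimensional vector space over an algebraically closed field k with a nondegenerate alternating (symplectic) form B, and let x = (x_1,...,x_g) be a tuple in sp(V)^g. If for some one-parameter subgroup λ: G_m → Sp(V) one has μ(x, λ) ≤ 0 (i.e. lim_{t→0} Ad(λ(t))·x exists), then the tuple x admits a nonzero totally isotropic invariant subspace. Conversely, if x admits a nonzero totally isotropic invariant subspace, then such a one-parameter subgroup into Sp(V) exists. -/

import Mathlib

open Matrix

noncomputable section

/-- The standard symplectic form matrix `J = [[0, -I_n],[I_n, 0]]`. -/
def Jmat (K : Type*) [Field K] (n : ℕ) : Matrix (Fin n ⊕ Fin n) (Fin n ⊕ Fin n) K :=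
  fromBlocks 0 (-1) 1 0

/-- The symplectic form `B(v, w) = vᵀ J w` on `K^{2n}`. -/
def sympForm (K : Type*) [Field K] (n : ℕ) (v w : Fin n ⊕ Fin n → K) : K :=
  v ⬝ᵥ (Jmat K n).mulVec w

open Module in
/-- Every totally isotropic subspace is contained in a Lagrangian one, that is, in a subspace
equal to its own orthogonal complement. -/
theorem exists_orthogonal_eq_self {K V : Type*} [Field K] [AddCommGroup V] [Module K V]
    [FiniteDimensional K V] {B : LinearMap.BilinForm K V} (hB : B.IsAlt)
    {W : Submodule K V} (hW : W ≤ B.orthogonal W) :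
    ∃ L : Submodule K V, W ≤ L ∧ B.orthogonal L = L := by
  obtain ⟨L, ⟨hWL, hL⟩, hmax⟩ := wellFounded_gt.has_min
    {L : Submodule K V | W ≤ L ∧ L ≤ B.orthogonal L} ⟨W, le_rfl, hW⟩
  refine ⟨L, hWL, le_antisymm (fun v hv => ?_) hL⟩
  have hiso : L ⊔ K ∙ v ≤ B.orthogonal (L ⊔ K ∙ v) := by
    intro a ha
    obtain ⟨a, haL, _, hs, rfl⟩ := Submodule.mem_sup.mp ha
    obtain ⟨s, rfl⟩ := Submodule.mem_span_singleton.mp hs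
    rw [LinearMap.BilinForm.mem_orthogonal_iff]
    intro b hb
    obtain ⟨b, hbL, _, ht, rfl⟩ := Submodule.mem_sup.mp hb
    obtain ⟨t, rfl⟩ := Submodule.mem_span_singleton.mp ht
    have h₁ : B b a = 0 := hL haL b hbL
    have h₂ : B b v = 0 := hv b hbL
    have h₃ : B v a = 0 := hB.isRefl a v (hv a haL)
    have h₄ : B v v = 0 := hB v
    simp [h₁, h₂, h₃, h₄]
  by_contra hvL
  refine hmax (L ⊔ K ∙ v) ⟨hWL.trans le_sup_left, hiso⟩ (lt_of_le_of_ne le_sup_left fun h => hvL ?_)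
  rw [h]
  exact Submodule.mem_sup_right (Submodule.mem_span_singleton_self v)

open Module in
/-- A linearly independent isotropic family for a nondegenerate alternating form can be completed
by a dual isotropic family. -/
theorem exists_dual_isotropic_family {K V ι : Type*} [Field K] (h2 : (2 : K) ≠ 0)
    [AddCommGroup V] [Module K V] [FiniteDimensional K V] [Fintype ι] [DecidableEq ι]
    {B : LinearMap.BilinForm K V} (hB : B.IsAlt) (hnd : B.Nondegenerate)
    {e : ι → V} (he : LinearIndependent K e) (hee : ∀ a b, B (e a) (e b) = 0) :
    ∃ f : ι → V, (∀ a b, B (f a) (f b) = 0) ∧ ∀ a b, B (f a) (e b) = if a = b then 1 else 0 := by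
  obtain ⟨φ, hφ⟩ := (Fintype.linearCombination K e).exists_leftInverse_of_injective
    (LinearMap.ker_eq_bot.mpr (he.fintypeLinearCombination_injective))
  have hφe : ∀ b, φ (e b) = Pi.single b 1 := fun b => by
    simpa using LinearMap.congr_fun hφ (Pi.single b 1)
  let f : ι → V := fun a => (B.toDual hnd).symm (LinearMap.proj a ∘ₗ φ)
  have hfe : ∀ a b, B (f a) (e b) = if a = b then 1 else 0 := fun a b => by
    simp [f, hφe, Pi.single_apply]
  have hef : ∀ a b, B (e a) (f b) = -if b = a then 1 else 0 := fun a b => by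
    rw [← hfe, hB.neg_eq]
  refine ⟨fun a => f a + ∑ c, (B (f a) (f c) / 2) • e c, fun a b => ?_, fun a b => ?_⟩
  · have hba : B (f b) (f a) = -B (f a) (f b) := (hB.neg_eq _ _).symm
    simp [map_sum, LinearMap.sum_apply, hee, hfe, hef, hba]
    field_simp
    ring
  · simp [map_sum, LinearMap.sum_apply, hee, hfe]

open Module in
/-- A totally isotropic subspace of a symplectic space of dimension `2n` is spanned by some of the
first `n` vectors of a symplectic basis. -/
theorem exists_symplectic_family {K V : Type*} [Field K] (h2 : (2 : K) ≠ 0)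
    [AddCommGroup V] [Module K V] [FiniteDimensional K V] {n : ℕ} (hn : finrank K V = n + n)
    {B : LinearMap.BilinForm K V} (hB : B.IsAlt) (hnd : B.Nondegenerate)
    {W : Submodule K V} (hW : W ≤ B.orthogonal W) :
    ∃ e f : Fin n → V, (∀ a b, B (e a) (e b) = 0) ∧ (∀ a b, B (f a) (f b) = 0) ∧
      (∀ a b, B (f a) (e b) = if a = b then 1 else 0) ∧
      W = Submodule.span K (e '' {a | e a ∈ W}) := by
  obtain ⟨L, hWL, hL⟩ := exists_orthogonal_eq_self hB hW
  obtain ⟨s, hsW, hs, hsi⟩ := exists_linearIndependent K (W : Set V)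
  obtain ⟨t, htL, hst, hLt, hti⟩ := exists_linearIndepOn_id_extension hsi (hsW.trans hWL)
  have hspan : Submodule.span K t = L := le_antisymm (Submodule.span_le.mpr htL) hLt
  have hti' : LinearIndependent K ((↑) : t → V) := hti
  have : Fintype t := @Fintype.ofFinite t hti'.finite
  have hcard : Fintype.card t = n := by
    have h₁ := finrank_span_eq_card hti'
    rw [Subtype.range_coe, hspan] at h₁
    have h₂ := LinearMap.BilinForm.finrank_orthogonal hnd L
    have h₃ := L.finrank_le
    rw [hL, hn] at h₂
    rw [hn] at h₃
    change _ = Fintype.card t at h₁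
    omega
  let E := (Fintype.equivFinOfCardEq hcard).symm
  let e : Fin n → V := fun a => E a
  have hee : ∀ a b, B (e a) (e b) = 0 := fun a b => by
    have : e b ∈ B.orthogonal L := by rw [hL]; exact htL (E b).2
    exact this _ (htL (E a).2)
  obtain ⟨f, hff, hfe⟩ := exists_dual_isotropic_family h2 hB hnd
    (hti'.comp E E.injective : LinearIndependent K e) hee
  refine ⟨e, f, hee, hff, hfe, le_antisymm ?_ (Submodule.span_le.mpr ?_)⟩
  · conv_lhs => rw [← Submodule.span_eq W, ← hs]
    refine Submodule.span_mono fun v hv => ⟨E.symm ⟨v, hst hv⟩, ?_, ?_⟩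
    · simpa [e] using hsW hv
    · simp [e]
  · rintro _ ⟨a, ha, rfl⟩
    exact ha

theorem sympForm_eq_toBilin' (K : Type*) [Field K] (n : ℕ) (v w : Fin n ⊕ Fin n → K) :
    sympForm K n v w = Matrix.toBilin' (Jmat K n) v w :=
  (Matrix.toBilin'_apply' _ _ _).symm

theorem sympForm_eq_sum (K : Type*) [Field K] (n : ℕ) (v w : Fin n ⊕ Fin n → K) :
    sympForm K n v w = ∑ a, (v (Sum.inr a) * w (Sum.inl a) - v (Sum.inl a) * w (Sum.inr a)) := by
  simp [sympForm, Jmat, fromBlocks_mulVec, dotProduct, Fintype.sum_sum_type, neg_mulVec,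
    Finset.sum_sub_distrib]
  ring

theorem sympForm_mulVec_mulVec {K : Type*} [Field K] {n : ℕ}
    (P : Matrix (Fin n ⊕ Fin n) (Fin n ⊕ Fin n) K) (v w : Fin n ⊕ Fin n → K) :
    sympForm K n (P *ᵥ v) (P *ᵥ w) = v ⬝ᵥ (Pᵀ * Jmat K n * P) *ᵥ w := by
  simp only [sympForm, ← mulVec_mulVec]
  rw [dotProduct_mulVec v, vecMul_transpose]

theorem Jmat_mul_Jmat (K : Type*) [Field K] (n : ℕ) : Jmat K n * Jmat K n = -1 :=
  Matrix.J_squared (Fin n) K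

theorem Jmat_mul_apply_inl {K : Type*} [Field K] {n : ℕ} {m : Type*}
    (M : Matrix (Fin n ⊕ Fin n) m K) (a : Fin n) (l : m) :
    (Jmat K n * M) (Sum.inl a) l = -M (Sum.inr a) l := by
  simp [Jmat, Matrix.mul_apply, Matrix.one_apply]

theorem Jmat_mul_apply_inr {K : Type*} [Field K] {n : ℕ} {m : Type*}
    (M : Matrix (Fin n ⊕ Fin n) m K) (a : Fin n) (l : m) :
    (Jmat K n * M) (Sum.inr a) l = M (Sum.inl a) l := by
  simp [Jmat, Matrix.mul_apply, Matrix.one_apply]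

theorem toBilin'_Jmat_isAlt (K : Type*) [Field K] (n : ℕ) :
    (Matrix.toBilin' (Jmat K n)).IsAlt := fun v => by
  rw [← sympForm_eq_toBilin', sympForm_eq_sum]
  exact Finset.sum_eq_zero fun a _ => by ring

theorem toBilin'_Jmat_nondegenerate (K : Type*) [Field K] (n : ℕ) :
    (Matrix.toBilin' (Jmat K n)).Nondegenerate :=
  LinearMap.BilinForm.nondegenerate_toBilin'_of_det_ne_zero' _
    (Matrix.isUnit_det_J (Fin n) K).ne_zero

theorem sympForm_mulVec_left {K : Type*} [Field K] {n : ℕ}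
    {x : Matrix (Fin n ⊕ Fin n) (Fin n ⊕ Fin n) K} (hx : xᵀ * Jmat K n + Jmat K n * x = 0)
    (v w : Fin n ⊕ Fin n → K) : sympForm K n (x *ᵥ v) w = -sympForm K n v (x *ᵥ w) := by
  have h : sympForm K n (x *ᵥ v) w = v ⬝ᵥ (xᵀ * Jmat K n) *ᵥ w := by
    rw [sympForm, ← mulVec_mulVec, dotProduct_mulVec v, vecMul_transpose]
  rw [h, eq_neg_of_add_eq_zero_left hx, neg_mulVec, dotProduct_neg, ← mulVec_mulVec, sympForm]

/-- The span of the columns of `P` of positive weight is totally isotropic and invariant. -/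
theorem exists_invariant_isotropic_of_weights {k : Type*} [Field k] {n g : ℕ}
    {x : Fin g → Matrix (Fin n ⊕ Fin n) (Fin n ⊕ Fin n) k}
    {P Q : Matrix (Fin n ⊕ Fin n) (Fin n ⊕ Fin n) k} {r : Fin n → ℤ}
    (hPQ : P * Q = 1) (hQP : Q * P = 1) (hP : Pᵀ * Jmat k n * P = Jmat k n) (hr : r ≠ 0)
    (h : ∀ (i : Fin g) (j l : Fin n ⊕ Fin n),
      Sum.elim r (fun a => -r a) j < Sum.elim r (fun a => -r a) l → (Q * x i * P) j l = 0) :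
    ∃ W : Submodule k (Fin n ⊕ Fin n → k), W ≠ ⊥ ∧
      (∀ v ∈ W, ∀ w ∈ W, sympForm k n v w = 0) ∧
      (∀ i, ∀ v ∈ W, (x i).mulVec v ∈ W) := by
  set wt : Fin n ⊕ Fin n → ℤ := Sum.elim r (fun a => -r a) with hwt
  let W : Submodule k (Fin n ⊕ Fin n → k) :=
    { carrier := {v | ∀ j, wt j ≤ 0 → (Q *ᵥ v) j = 0}
      add_mem' := fun ha hb j hj => by simp [mulVec_add, ha j hj, hb j hj]
      zero_mem' := fun j _ => by simp
      smul_mem' := fun c v hv j hj => by simp [mulVec_smul, hv j hj] }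
  have hPQv : ∀ v, P *ᵥ (Q *ᵥ v) = v := fun v => by rw [mulVec_mulVec, hPQ, one_mulVec]
  have hQPv : ∀ v, Q *ᵥ (P *ᵥ v) = v := fun v => by rw [mulVec_mulVec, hQP, one_mulVec]
  refine ⟨W, ?_, fun v hv w hw => ?_, fun i v hv j hj => ?_⟩
  · obtain ⟨l, hl⟩ : ∃ l, 0 < wt l := by
      obtain ⟨a, ha⟩ := Function.ne_iff.mp hr
      rcases lt_or_gt_of_ne ha with ha | ha
      · exact ⟨Sum.inr a, by simpa [hwt] using ha⟩
      · exact ⟨Sum.inl a, by simpa [hwt] using ha⟩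
    refine (Submodule.ne_bot_iff W).mpr ⟨P *ᵥ Pi.single l 1, fun j hj => ?_, fun h0 => ?_⟩
    · rw [hQPv, Pi.single_eq_of_ne]
      rintro rfl
      omega
    · have := congrFun (hQPv (Pi.single l 1)) l
      simp [h0] at this
  · rw [← hPQv v, ← hPQv w, sympForm_mulVec_mulVec, hP]
    refine (sympForm_eq_sum k n _ _).trans (Finset.sum_eq_zero fun a _ => ?_)
    rcases le_total (r a) 0 with ha | ha
    · simp [hv (Sum.inl a) (by simpa [hwt] using ha), hw (Sum.inl a) (by simpa [hwt] using ha)]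
    · simp [hv (Sum.inr a) (by simpa [hwt] using ha), hw (Sum.inr a) (by simpa [hwt] using ha)]
  · have : Q *ᵥ (x i *ᵥ v) = (Q * x i * P) *ᵥ (Q *ᵥ v) := by
      rw [← mulVec_mulVec, hPQv, ← mulVec_mulVec]
    rw [this]
    refine (Finset.sum_eq_zero fun l _ => ?_ : ∑ l, (Q * x i * P) j l * (Q *ᵥ v) l = 0)
    rcases le_or_gt (wt l) 0 with hl | hl
    · simp [hv l hl]
    · simp [h i j l (by omega)]

/-- Weight one on the isotropic invariant subspace `W` and zero on a complement of `W` in a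
Lagrangian subspace gives a destabilizing one-parameter subgroup. -/
theorem exists_weights_of_invariant_isotropic {k : Type*} [Field k] (h2 : (2 : k) ≠ 0) {n g : ℕ}
    {x : Fin g → Matrix (Fin n ⊕ Fin n) (Fin n ⊕ Fin n) k}
    (hx : ∀ i, (x i)ᵀ * Jmat k n + Jmat k n * x i = 0)
    {W : Submodule k (Fin n ⊕ Fin n → k)} (hW : W ≠ ⊥)
    (hiso : ∀ v ∈ W, ∀ w ∈ W, sympForm k n v w = 0)
    (hinv : ∀ i, ∀ v ∈ W, (x i).mulVec v ∈ W) :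
    ∃ (P Q : Matrix (Fin n ⊕ Fin n) (Fin n ⊕ Fin n) k) (r : Fin n → ℤ),
      P * Q = 1 ∧ Q * P = 1 ∧ Pᵀ * Jmat k n * P = Jmat k n ∧ r ≠ 0 ∧
      (∀ (i : Fin g) (j l : Fin n ⊕ Fin n),
        Sum.elim r (fun a => -r a) j < Sum.elim r (fun a => -r a) l →
          (Q * x i * P) j l = 0) := by
  classical
  have halt := toBilin'_Jmat_isAlt k n
  obtain ⟨e, f, hee, hff, hfe, hspan⟩ := exists_symplectic_family h2 (n := n) (W := W) (by simp)
    halt (toBilin'_Jmat_nondegenerate k n)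
    (fun v hv w hw => by
      rw [← sympForm_eq_toBilin']; exact hiso w hw v hv)
  have hef : ∀ a b, sympForm k n (e a) (f b) = -if b = a then 1 else 0 := fun a b => by
    rw [sympForm_eq_toBilin', ← halt.neg_eq, hfe]
  simp only [← sympForm_eq_toBilin'] at hee hff hfe
  have hskew : ∀ v w, sympForm k n v w = -sympForm k n w v := fun v w => by
    simp only [sympForm_eq_toBilin', halt.neg_eq]
  set p : Fin n ⊕ Fin n → Fin n ⊕ Fin n → k := Sum.elim e f with hp
  let P : Matrix (Fin n ⊕ Fin n) (Fin n ⊕ Fin n) k := Matrix.of fun j l => p l j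
  have hentry : ∀ (M : Matrix (Fin n ⊕ Fin n) (Fin n ⊕ Fin n) k) j l,
      (Pᵀ * (Jmat k n * (M * P))) j l = sympForm k n (p j) (M *ᵥ p l) :=
    fun _ _ _ => rfl
  have hP : Pᵀ * Jmat k n * P = Jmat k n := by
    ext j l
    have := hentry 1 j l
    rw [Matrix.one_mul, one_mulVec] at this
    rw [Matrix.mul_assoc, this]
    rcases j with a | a <;> rcases l with b | b <;>
      simp [hp, Jmat, hee, hff, hfe, hef, Matrix.one_apply, eq_comm]
  let Q : Matrix (Fin n ⊕ Fin n) (Fin n ⊕ Fin n) k := -(Jmat k n * (Pᵀ * Jmat k n))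
  have hQP : Q * P = 1 := by
    rw [Matrix.neg_mul, Matrix.mul_assoc, hP, Jmat_mul_Jmat, neg_neg]
  let r : Fin n → ℤ := fun a => if e a ∈ W then 1 else 0
  have horth : ∀ j, 0 ≤ Sum.elim r (fun a => -r a) j → ∀ w ∈ W, sympForm k n (p j) w = 0 := by
    intro j hj w hw
    rw [hspan] at hw
    induction hw using Submodule.span_induction with
    | mem w hw =>
      obtain ⟨b, hb, rfl⟩ := hw
      rcases j with a | a
      · exact hee a b
      · have ha : e a ∉ W := fun ha => by simp [r, ha] at hj
        have hab : a ≠ b := by rintro rfl; exact ha hb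
        simp [hp, hfe, hab]
    | zero => simp [sympForm]
    | add v w _ _ hv hw => simp only [sympForm_eq_toBilin'] at *; simp [hv, hw]
    | smul c v _ hv => simp only [sympForm_eq_toBilin'] at *; simp [hv]
  have hmem : ∀ j, 0 < Sum.elim r (fun a => -r a) j → p j ∈ W := by
    rintro (a | a) hj
    · by_contra ha
      simp [r, show e a ∉ W from ha] at hj
    · simp only [Sum.elim_inr, r] at hj
      split_ifs at hj <;> omega
  have hpair : ∀ i j l, 0 < Sum.elim r (fun a => -r a) j + Sum.elim r (fun a => -r a) l →
      sympForm k n (p j) (x i *ᵥ p l) = 0 := by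
    intro i j l hjl
    have hle : ∀ j, Sum.elim r (fun a => -r a) j ≤ 1 := by
      rintro (a | a) <;> simp only [Sum.elim_inl, Sum.elim_inr, r] <;> split_ifs <;> omega
    have hj := hle j
    have hl := hle l
    rcases lt_or_ge 0 (Sum.elim r (fun a => -r a) l) with hl' | hl'
    · exact horth j (by omega) _ (hinv i _ (hmem l hl'))
    · rw [← neg_eq_zero, ← sympForm_mulVec_left (hx i), hskew, neg_eq_zero]
      exact horth l (by omega) _ (hinv i _ (hmem j (by omega)))
  refine ⟨P, Q, r, mul_eq_one_comm.mp hQP, hQP, hP, ?_, fun i j l hjl => ?_⟩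
  · intro hr
    apply hW
    rw [hspan, Submodule.span_eq_bot]
    rintro _ ⟨a, ha, rfl⟩
    have := congrFun hr a
    simp [r, show e a ∈ W from ha] at this
  · have hQ : Q * x i * P = -(Jmat k n * (Pᵀ * (Jmat k n * (x i * P)))) := by
      simp only [Q, Matrix.neg_mul, Matrix.mul_assoc]
    rw [hQ]
    rcases j with a | a
    · have := hpair i (Sum.inr a) l (by simp at hjl ⊢; omega)
      rw [← hentry] at this
      rw [Matrix.neg_apply, Jmat_mul_apply_inl, this, neg_zero, neg_zero]
    · have := hpair i (Sum.inl a) l (by simp at hjl ⊢; omega)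
      rw [← hentry] at this
      rw [Matrix.neg_apply, Jmat_mul_apply_inr, this, neg_zero]


/-- Hilbert–Mumford for `Sp`: for a tuple `x` in `sp(V)^g` over
an algebraically closed field of characteristic zero, there exists a nontrivial
one-parameter subgroup `λ` of `Sp(V)` with `μ(x, λ) ≤ 0` (i.e. a symplectic
base change `P` and nonzero integer weights `r` such that each conjugated `x_i`
is block triangular: entries with strictly increasing weight vanish) if and
only if `x` admits a nonzero totally isotropic invariant subspace. -/
theorem stmt15 (k : Type*) [Field k] [CharZero k] [IsAlgClosed k] (n g : ℕ)
    (x : Fin g → Matrix (Fin n ⊕ Fin n) (Fin n ⊕ Fin n) k)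
    (hx : ∀ i, (x i)ᵀ * Jmat k n + Jmat k n * x i = 0) :
    (∃ (P Q : Matrix (Fin n ⊕ Fin n) (Fin n ⊕ Fin n) k) (r : Fin n → ℤ),
      P * Q = 1 ∧ Q * P = 1 ∧ Pᵀ * Jmat k n * P = Jmat k n ∧ r ≠ 0 ∧
      (∀ (i : Fin g) (j l : Fin n ⊕ Fin n),
        Sum.elim r (fun a => -r a) j < Sum.elim r (fun a => -r a) l →
          (Q * x i * P) j l = 0)) ↔
    (∃ W : Submodule k (Fin n ⊕ Fin n → k), W ≠ ⊥ ∧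
      (∀ v ∈ W, ∀ w ∈ W, sympForm k n v w = 0) ∧
      (∀ i, ∀ v ∈ W, (x i).mulVec v ∈ W)) := by
  constructor
  · rintro ⟨P, Q, r, hPQ, hQP, hP, hr, h⟩
    exact exists_invariant_isotropic_of_weights hPQ hQP hP hr h
  · rintro ⟨W, hW, hiso, hinv⟩
    exact exists_weights_of_invariant_isotropic two_ne_zero hx hW hiso hinv
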